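/- arXiv:1406.4278 — 3 statements merged into one kernel-verified Lean document; each statement's English description precedes it below -/
import Mathlib

section
/- Let p ≥ q ≥ 1 be natural numbers and let R = MvPolynomial (Fin p × Fin q) ℂ be the polynomial ring over ℂ in the entries x_{ij} of a generic p×q matrix X. Then the ideal of R generated by the maximal minors of X (the determinants of the q×q submatrices of X given by all strictly increasing row selections σ : Fin q → Fin p) is a prime ideal. -/
/-- The generic `p×q` matrix, whose entries are the variables of the polynomial ring
`ℂ[x_{ij}]`. -/
noncomputable def genericMatrix (p q : ℕ) :
    Matrix (Fin p) (Fin q) (MvPolynomial (Fin p × Fin q) ℂ) :=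
  fun i j => MvPolynomial.X (i, j)

/-- The ideal of the polynomial ring `ℂ[x_{ij}]` generated by the maximal (`q×q`) minors of
the generic `p×q` matrix: the determinants of the submatrices given by all strictly
increasing row selections `σ : Fin q → Fin p`. -/
noncomputable def maximalMinorsIdeal (p q : ℕ) : Ideal (MvPolynomial (Fin p × Fin q) ℂ) :=
  Ideal.span {d | ∃ σ : Fin q → Fin p, StrictMono σ ∧
    d = ((genericMatrix p q).submatrix σ id).det}

section helpers
open MvPolynomial

/-- Greedy choice of rows. -/
lemma greedy_rows (S : ℕ → ℕ → Prop) (p : ℕ) (hS : ∀ i j, p ≤ i → S i j) :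
    ∃ σ : ℕ → ℕ, StrictMono σ ∧ (∀ j, S (σ j) j) ∧
      ∀ i j, i < σ j → (∀ l, l < j → σ l < i) → ¬ S i j := by
  classical
  have hex : ∀ b j, ∃ i, b ≤ i ∧ S i j := fun b j =>
    ⟨max b p, le_max_left _ _, hS _ _ (le_max_right _ _)⟩
  let σ : ℕ → ℕ := fun j => Nat.rec (Nat.find (hex 0 0))
    (fun l r => Nat.find (hex (r + 1) (l + 1))) j
  have h0 : σ 0 = Nat.find (hex 0 0) := rfl
  have hs : ∀ l, σ (l + 1) = Nat.find (hex (σ l + 1) (l + 1)) := fun l => rfl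
  refine ⟨σ, strictMono_nat_of_lt_succ fun l => ?_, fun j => ?_, fun i j hi hl hSij => ?_⟩
  · rw [hs]
    exact (Nat.find_spec (hex (σ l + 1) (l + 1))).1
  · cases j with
    | zero => rw [h0]; exact (Nat.find_spec (hex 0 0)).2
    | succ l => rw [hs]; exact (Nat.find_spec (hex (σ l + 1) (l + 1))).2
  · cases j with
    | zero => rw [h0] at hi; exact Nat.find_min _ hi ⟨Nat.zero_le _, hSij⟩
    | succ l => rw [hs] at hi; exact Nat.find_min _ hi ⟨hl l (Nat.lt_succ_self l), hSij⟩

/-- Partial sums. -/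
def rowSum (σ : ℕ → ℕ) (j : ℕ) : ℕ := ∑ l ∈ Finset.range j, σ l

lemma rowSum_succ (σ : ℕ → ℕ) (j : ℕ) : rowSum σ (j + 1) = rowSum σ j + σ j :=
  Finset.sum_range_succ _ _

lemma rowSum_up (σ : ℕ → ℕ) (hσ : StrictMono σ) (i k d : ℕ) (hi : i ≤ σ k) :
    i * (k + d) + rowSum σ k + (if d = 0 then 0 else (d - 1) + (σ k - i)) ≤
      i * k + rowSum σ (k + d) := by
  induction d with
  | zero => simp
  | succ d ih =>
    rw [← add_assoc k d 1, rowSum_succ, mul_add i (k + d) 1]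
    have h1 : σ k + d ≤ σ (k + d) := by
      clear ih
      induction d with
      | zero => simp
      | succ d ih => have := hσ (show k + d < k + (d + 1) by omega); omega
    rcases Nat.eq_zero_or_pos d with rfl | hd
    · simp; omega
    · simp [hd.ne'] at ih ⊢; omega

lemma rowSum_down (σ : ℕ → ℕ) (i j d : ℕ) (hi : ∀ l, l < j + d → σ l < i) :
    i * j + rowSum σ (j + d) + d ≤ i * (j + d) + rowSum σ j := by
  induction d with
  | zero => simp
  | succ d ih =>
    have := ih (fun l hl => hi l (by omega))
    have h2 := hi (j + d) (by omega)
    rw [← add_assoc j d 1, rowSum_succ, mul_add i (j + d) 1]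
    omega

/-- The exponent gap. -/
def gap (σ : ℕ → ℕ) (i k j : ℕ) : ℕ := (i * k + rowSum σ j) - (i * j + rowSum σ k)

lemma gap_add (σ : ℕ → ℕ) (hσ : StrictMono σ) (i k j : ℕ) (hi : i ≤ σ k)
    (hl : ∀ l, l < k → σ l < i) :
    (i * j + rowSum σ k) + gap σ i k j = i * k + rowSum σ j ∧
    (gap σ i k j = 0 → j = k ∨ (j = k + 1 ∧ i = σ k)) := by
  unfold gap
  rcases le_or_gt k j with h | h
  · obtain ⟨d, rfl⟩ := Nat.exists_eq_add_of_le h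
    have := rowSum_up σ hσ i k d hi
    refine ⟨by omega, fun h0 => ?_⟩
    rcases Nat.eq_zero_or_pos d with rfl | hd
    · simp
    · rw [if_neg hd.ne'] at this
      right; omega
  · obtain ⟨d, rfl⟩ := Nat.exists_eq_add_of_le h.le
    have := rowSum_down σ i j d hl
    refine ⟨by omega, fun h0 => ?_⟩
    omega

lemma gap_self (σ : ℕ → ℕ) (i k : ℕ) : gap σ i k k = 0 := by simp [gap]

lemma gap_tie (σ : ℕ → ℕ) (k : ℕ) : gap σ (σ k) k (k + 1) = 0 := by
  simp [gap, rowSum_succ, mul_add]; omega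

/-- Kernel vector coefficients. -/
noncomputable def cvec (σ : ℕ → ℕ) (y : ℕ → ℕ → ℂ) : ℕ → ℂ
  | 0 => 1
  | j + 1 => - (cvec σ y j * y (σ j) j / y (σ j) (j + 1))

lemma cvec_ne (σ : ℕ → ℕ) (y : ℕ → ℕ → ℂ) (hy : ∀ i j, y i j ≠ 0) (j : ℕ) :
    cvec σ y j ≠ 0 := by
  induction j with
  | zero => simp [cvec]
  | succ j ih => simp [cvec, ih, hy]

/-- The family of singular matrices degenerating to a given masked matrix. -/
lemma degeneration (p n : ℕ) (σ : ℕ → ℕ) (hσ : StrictMono σ) (hp : p ≤ σ n)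
    (k : ℕ → ℕ) (hk : ∀ i, i ≤ σ (k i)) (hk' : ∀ i l, l < k i → σ l < i)
    (y : ℕ → ℕ → ℂ) (hy : ∀ i j, y i j ≠ 0) :
    ∃ X : ℕ → ℕ → ℂ → ℂ, (∀ i j, Continuous (X i j)) ∧
      (∀ i < p, ∀ j, X i j 0 = if j = k i ∧ i ≠ σ j then 0 else y i j) ∧
      ∀ s : ℂ, s ≠ 0 → ∃ v : ℕ → ℂ, v 0 = 1 ∧ ∀ i < p,
        ∑ j ∈ Finset.range (n + 1), v j * ((s ^ (i * j))⁻¹ * X i j s) = 0 := by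
  let x : ℕ → ℕ → ℂ := fun i j => if j = k i ∧ i ≠ σ j then 0 else y i j
  let c := cvec σ y
  have hc : ∀ j, c j ≠ 0 := cvec_ne σ y hy
  let T : ℕ → ℂ → ℂ := fun i s =>
    ∑ l ∈ Finset.range (n + 1), c l * s ^ (gap σ i (k i) l) * x i l
  have hkn : ∀ i < p, k i ≤ n := fun i hi => by
    by_contra h
    have := hk' i n (by omega)
    omega
  refine ⟨fun i j s => x i j - if j = k i then (c (k i))⁻¹ * T i s else 0, ?_, ?_, ?_⟩
  · intro i j
    by_cases h : j = k i
    · simp only [h, if_true, T]; fun_prop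
    · simp only [h, if_false]; fun_prop
  · intro i hi j
    have hT : T i 0 = 0 := by
      by_cases hs : i = σ (k i)
      · have hk1 : k i + 1 ≤ n := by
          by_contra h
          have : k i = n := by have := hkn i hi; omega
          rw [this] at hs; omega
        have : T i 0 = ∑ l ∈ ({k i, k i + 1} : Finset ℕ),
            c l * 0 ^ (gap σ i (k i) l) * x i l := by
          symm
          apply Finset.sum_subset
          · intro l hl
            simp at hl ⊢; omega
          · intro l _ hl
            have h0 : gap σ i (k i) l ≠ 0 := fun h0 => by
              have := (gap_add σ hσ i (k i) l (hk i) (hk' i)).2 h0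
              simp at hl; omega
            simp [h0]
        rw [this, Finset.sum_pair (by omega), gap_self]
        have h1 : gap σ i (k i) (k i + 1) = 0 := by
          conv_lhs => rw [hs]
          rw [← hs]
          have := gap_tie σ (k i)
          rwa [← hs] at this
        have hx1 : x i (k i) = y i (k i) := by simp [x, ← hs]
        have hx2 : x i (k i + 1) = y i (k i + 1) := by simp [x]
        rw [h1, hx1, hx2]
        have : c (k i + 1) = - (c (k i) * y i (k i) / y i (k i + 1)) := by
          simp only [c, cvec, ← hs]
        rw [this]
        have := hy i (k i + 1)
        field_simp
        ring
      · apply Finset.sum_eq_zero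
        intro l _
        by_cases h0 : gap σ i (k i) l = 0
        · rcases (gap_add σ hσ i (k i) l (hk i) (hk' i)).2 h0 with h | h
          · subst h; simp [x, hs]
          · exact absurd h.2 hs
        · simp [h0]
    simp only [hT, mul_zero, ite_self, sub_zero, x]
  · intro s hs
    refine ⟨fun j => c j * s ^ rowSum σ j, by simp [c, cvec, rowSum], fun i hi => ?_⟩
    have key : ∀ j, s ^ rowSum σ j * (s ^ (i * j))⁻¹ =
        (s ^ rowSum σ (k i) * (s ^ (i * k i))⁻¹) * s ^ gap σ i (k i) j := by
      intro j
      have := (gap_add σ hσ i (k i) j (hk i) (hk' i)).1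
      field_simp
      simp only [← pow_add]
      congr 1
      omega
    have : ∀ j, c j * s ^ rowSum σ j * ((s ^ (i * j))⁻¹ *
        (x i j - if j = k i then (c (k i))⁻¹ * T i s else 0)) =
        (s ^ rowSum σ (k i) * (s ^ (i * k i))⁻¹) * (c j * s ^ gap σ i (k i) j * x i j) -
        if j = k i then (s ^ rowSum σ (k i) * (s ^ (i * k i))⁻¹) * T i s else 0 := by
      intro j
      have h1 : c j * s ^ rowSum σ j * ((s ^ (i * j))⁻¹ *
        (x i j - if j = k i then (c (k i))⁻¹ * T i s else 0)) =
        c j * (s ^ rowSum σ j * (s ^ (i * j))⁻¹) *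
        (x i j - if j = k i then (c (k i))⁻¹ * T i s else 0) := by ring
      rw [h1, key]
      split_ifs with h
      · subst h
        rw [gap_self]
        have := hc (k i)
        have h2 : c (k i) * (c (k i))⁻¹ = 1 := mul_inv_cancel₀ this
        linear_combination (-(s ^ rowSum σ (k i) * (s ^ (i * k i))⁻¹) * T i s) * h2
      · ring
    rw [Finset.sum_congr rfl (fun j _ => this j), Finset.sum_sub_distrib, ← Finset.mul_sum,
      Finset.sum_ite_eq', if_pos (Finset.mem_range.2 (by have := hkn i hi; omega))]
    simp [T]


/-- Parametrization of singular matrices: column zero is a combination of the others. -/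
noncomputable def paramHom (p n : ℕ) : MvPolynomial (Fin p × Fin (n + 1)) ℂ →ₐ[ℂ]
    MvPolynomial ((Fin p × Fin n) ⊕ Fin n) ℂ :=
  aeval fun ij => Fin.cases (motive := fun _ => MvPolynomial ((Fin p × Fin n) ⊕ Fin n) ℂ)
    (-∑ l, X (Sum.inr l) * X (Sum.inl (ij.1, l)))
    (fun l => X (Sum.inl (ij.1, l))) ij.2

lemma minors_le_ker (p n : ℕ) : maximalMinorsIdeal p (n + 1) ≤ RingHom.ker (paramHom p n) := by
  unfold maximalMinorsIdeal
  rw [Ideal.span_le]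
  rintro d ⟨σ, -, rfl⟩
  simp only [SetLike.mem_coe, RingHom.mem_ker]
  rw [AlgHom.map_det]
  apply Matrix.exists_mulVec_eq_zero_iff.1
  refine ⟨Fin.cons 1 (fun l => X (Sum.inr l)), fun h => ?_, ?_⟩
  · have := congrFun h 0
    simp at this
  · ext1 i
    simp [Matrix.mulVec, dotProduct, Fin.sum_univ_succ, genericMatrix, paramHom, mul_comm]

lemma eval_eq_zero_of_ker (p n : ℕ) (f : MvPolynomial (Fin p × Fin (n + 1)) ℂ)
    (hf : f ∈ RingHom.ker (paramHom p n)) (Z : Fin p × Fin (n + 1) → ℂ) (v : Fin (n + 1) → ℂ)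
    (hv : v 0 = 1) (hZ : ∀ i, ∑ j, v j * Z (i, j) = 0) : eval Z f = 0 := by
  let e : ((Fin p × Fin n) ⊕ Fin n) → ℂ :=
    Sum.elim (fun il => Z (il.1, il.2.succ)) (fun l => v l.succ)
  have h : aeval Z = (aeval e).comp (paramHom p n) := by
    apply MvPolynomial.algHom_ext
    rintro ⟨i, j⟩
    have := hZ i
    rw [Fin.sum_univ_succ, hv, one_mul] at this
    refine Fin.cases ?_ (fun l => ?_) j
    · simp [paramHom, e]
      linear_combination this
    · simp [paramHom, e]
  have h2 : aeval Z f = aeval e (paramHom p n f) := by rw [h]; rfl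
  rw [RingHom.mem_ker.1 hf, map_zero] at h2
  simpa [aeval_eq_eval] using h2

/-- The weight of a monomial. -/
noncomputable def wt {p q : ℕ} (m : Fin p × Fin q →₀ ℕ) : ℕ :=
  Finsupp.weight (fun ij : Fin p × Fin q => (ij.1 : ℕ) * (ij.2 : ℕ)) m

lemma wt_add {p q : ℕ} (m m' : Fin p × Fin q →₀ ℕ) : wt (m + m') = wt m + wt m' := map_add _ _ _

lemma wt_eq {p q : ℕ} (m : Fin p × Fin q →₀ ℕ) :
    wt m = ∑ ij, m ij * ((ij.1 : ℕ) * (ij.2 : ℕ)) := by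
  unfold wt
  rw [Finsupp.weight_apply, Finsupp.sum_fintype _ _ (by simp)]
  simp

/-- Exponent of the product of entries in positions `(τ j, j)`. -/
noncomputable def dexp {p q : ℕ} (τ : Fin q → Fin p) : Fin p × Fin q →₀ ℕ :=
  ∑ j, Finsupp.single (τ j, j) 1

lemma dexp_apply {p q : ℕ} (τ : Fin q → Fin p) (i : Fin p) (j : Fin q) :
    dexp τ (i, j) = if τ j = i then 1 else 0 := by
  unfold dexp
  rw [Finsupp.finsetSum_apply, Finset.sum_eq_single j]
  · simp [Finsupp.single_apply]
  · intro b _ hb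
    simp [hb]
  · simp

lemma wt_dexp {p q : ℕ} (τ : Fin q → Fin p) : wt (dexp τ) = ∑ j, (τ j : ℕ) * (j : ℕ) := by
  unfold wt dexp
  rw [map_sum]
  simp [Finsupp.weight_single]

lemma wt_dexp_lt {p q : ℕ} (σ : Fin q → Fin p) (hσ : StrictMono σ) (π : Equiv.Perm (Fin q))
    (hπ : π ≠ 1) : wt (dexp (fun j => σ (π j))) < wt (dexp σ) := by
  rw [wt_dexp, wt_dexp]
  have hmono : Monovary (fun j => (σ j : ℕ)) (fun j : Fin q => (j : ℕ)) := by
    intro a b hab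
    exact hσ.monotone (le_of_lt (show a < b from hab))
  refine (hmono.sum_comp_perm_mul_lt_sum_mul_iff (σ := π)).2 fun h => hπ ?_
  have hmonoπ : StrictMono π := by
    apply Monotone.strictMono_of_injective _ π.injective
    intro a b hab
    rcases hab.eq_or_lt with rfl | hab
    · exact le_rfl
    · exact hσ.le_iff_le.1 (h (show (a : ℕ) < b from hab))
  let e : Fin q ≃o Fin q := hmonoπ.orderIsoOfSurjective _ π.surjective
  have : e = OrderIso.refl _ := Subsingleton.elim _ _
  ext j
  have := congrArg (fun e : Fin q ≃o Fin q => ((e j : Fin q) : ℕ)) this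
  simpa [e] using this

lemma minor_eq {p q : ℕ} (σ : Fin q → Fin p) :
    ((genericMatrix p q).submatrix σ id).det =
      ∑ π : Equiv.Perm (Fin q), (Equiv.Perm.sign π : ℤ) •
        monomial (dexp (fun j => σ (π j))) (1 : ℂ) := by
  rw [Matrix.det_apply]
  refine Finset.sum_congr rfl fun π _ => ?_
  rw [dexp, monomial_sum_one]
  rfl

/-- Normal monomials: not divisible by a diagonal. -/
def normalSet (p q : ℕ) : Set (Fin p × Fin q →₀ ℕ) :=
  {m | ¬ ∃ σ : Fin q → Fin p, StrictMono σ ∧ ∀ j, m (σ j, j) ≠ 0}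

lemma monomial_reduce (p q : ℕ) (N : ℕ) : ∀ m : Fin p × Fin q →₀ ℕ, wt m = N →
    monomial m (1 : ℂ) ∈ (maximalMinorsIdeal p q).restrictScalars ℂ ⊔
      restrictSupport ℂ (normalSet p q) := by
  induction N using Nat.strong_induction_on with
  | _ N ih =>
    intro m hm
    by_cases hn : m ∈ normalSet p q
    · apply Submodule.mem_sup_right
      simp [hn]
    · simp only [normalSet, Set.mem_ofPred_eq, not_not] at hn
      obtain ⟨σ, hσ, hm0⟩ := hn
      have hle : dexp σ ≤ m := by
        rintro ⟨i, j⟩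
        rw [dexp_apply]
        split_ifs with h
        · subst h; exact Nat.one_le_iff_ne_zero.2 (hm0 j)
        · exact Nat.zero_le _
      obtain ⟨m', rfl⟩ := exists_add_of_le hle
      have h1 := minor_eq σ
      rw [← Finset.add_sum_erase _ _ (Finset.mem_univ (1 : Equiv.Perm (Fin q)))] at h1
      have h2 : monomial (dexp σ + m') (1 : ℂ) =
          monomial m' 1 * ((genericMatrix p q).submatrix σ id).det -
          ∑ π ∈ Finset.univ.erase (1 : Equiv.Perm (Fin q)), (Equiv.Perm.sign π : ℤ) •
            monomial (dexp (fun j => σ (π j)) + m') (1 : ℂ) := by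
        have h3 : ∀ π : Equiv.Perm (Fin q), monomial m' (1 : ℂ) * ((Equiv.Perm.sign π : ℤ) •
            monomial (dexp (fun j => σ (π j))) (1 : ℂ)) = (Equiv.Perm.sign π : ℤ) •
            monomial (dexp (fun j => σ (π j)) + m') (1 : ℂ) := by
          intro π
          rw [mul_smul_comm, monomial_mul, mul_one, add_comm]
        rw [h1, mul_add, Finset.mul_sum, h3, Finset.sum_congr rfl (fun π _ => h3 π),
          add_sub_cancel_right]
        simp
      rw [h2]
      apply Submodule.sub_mem
      · apply Submodule.mem_sup_left
        simp only [Submodule.restrictScalars_mem]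
        exact Ideal.mul_mem_left _ _ (Ideal.subset_span ⟨σ, hσ, rfl⟩)
      · refine Submodule.sum_mem _ fun π hπ => ?_
        apply zsmul_mem
        refine ih _ ?_ _ rfl
        rw [← hm, wt_add, wt_add]
        have := wt_dexp_lt σ hσ π (Finset.ne_of_mem_erase hπ)
        omega

lemma poly_reduce (p q : ℕ) (f : MvPolynomial (Fin p × Fin q) ℂ) :
    f ∈ (maximalMinorsIdeal p q).restrictScalars ℂ ⊔ restrictSupport ℂ (normalSet p q) := by
  rw [f.as_sum]
  refine Submodule.sum_mem _ fun m _ => ?_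
  have := Submodule.smul_mem _ (coeff m f) (monomial_reduce p q _ m rfl)
  simpa [smul_monomial] using this

lemma normal_ker_zero (p n : ℕ) (r : MvPolynomial (Fin p × Fin (n + 1)) ℂ)
    (hr : r ∈ restrictSupport ℂ (normalSet p (n + 1)))
    (hk : r ∈ RingHom.ker (paramHom p n)) : r = 0 := by
  classical
  by_contra hne
  obtain ⟨m, hm, hmax⟩ := Finset.exists_max_image r.support wt (by simpa using hne)
  have hmn : m ∈ normalSet p (n + 1) := ((mem_restrictSupport_iff ℂ).1 hr) hm
  set W := wt m with hW
  obtain ⟨σ, hσ, hσS, hσmin⟩ := greedy_rows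
    (fun i j => p ≤ i ∨ ∃ (hi : i < p) (hj : j < n + 1), m (⟨i, hi⟩, ⟨j, hj⟩) ≠ 0) p
    (fun i j h => Or.inl h)
  have hp : p ≤ σ n := by
    by_contra hlt
    push Not at hlt
    have hb : ∀ j : Fin (n + 1), σ j < p := fun j =>
      lt_of_le_of_lt (hσ.monotone (by omega)) hlt
    refine hmn ⟨fun j => ⟨σ j, hb j⟩, fun a b hab => hσ hab, fun j => ?_⟩
    rcases hσS j with h | ⟨_, _, h⟩
    · have := hb j; omega
    · exact h
  have hex : ∀ i, ∃ k, i ≤ σ k := fun i => ⟨i, hσ.le_apply⟩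
  let k : ℕ → ℕ := fun i => Nat.find (hex i)
  have hk1 : ∀ i, i ≤ σ (k i) := fun i => Nat.find_spec (hex i)
  have hk2 : ∀ i l, l < k i → σ l < i := fun i l hl => not_le.1 (Nat.find_min (hex i) hl)
  -- the support mask
  let B : Fin p × Fin (n + 1) → Prop := fun ij => (ij.2 : ℕ) = k ij.1 ∧ (ij.1 : ℕ) ≠ σ ij.2
  have hmB : ∀ ij, B ij → m ij = 0 := by
    rintro ⟨i, j⟩ ⟨h1, h2⟩
    simp only at h1 h2
    by_contra h0
    refine hσmin i j ?_ ?_ (Or.inr ⟨i.2, j.2, h0⟩)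
    · have := hk1 i; rw [← h1] at this; omega
    · rw [h1]; exact hk2 i
  let g : MvPolynomial (Fin p × Fin (n + 1)) ℂ :=
    ∑ d ∈ r.support with wt d = W ∧ ∀ ij, B ij → d ij = 0, monomial d (coeff d r)
  have hg : g = 0 := by
    refine funext_set (fun _ => ({0}ᶜ : Set ℂ)) (fun _ => (Set.finite_singleton 0).infinite_compl) ?_
    intro y hy
    have hy0 : ∀ ij, y ij ≠ 0 := fun ij => by simpa using hy ij (Set.mem_univ _)
    let y' : ℕ → ℕ → ℂ := fun i j =>
      if h : i < p ∧ j < n + 1 then y (⟨i, h.1⟩, ⟨j, h.2⟩) else 1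
    have hy' : ∀ i j, y' i j ≠ 0 := by
      intro i j
      simp only [y']
      split_ifs
      · exact hy0 _
      · exact one_ne_zero
    obtain ⟨X', hcont, hX0, hXs⟩ := degeneration p n σ hσ hp k hk1 hk2 y' hy'
    let G : ℂ → ℂ := fun s => ∑ d ∈ r.support, coeff d r * (s ^ (W - wt d) *
      ∏ ij : Fin p × Fin (n + 1), X' ij.1 ij.2 s ^ d ij)
    have hGc : Continuous G := by
      refine continuous_finsetSum _ fun d _ => ?_
      refine continuous_const.mul ((continuous_pow _).mul ?_)
      exact continuous_finsetProd _ fun ij _ => (hcont _ _).pow _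
    have hGs : ∀ s, s ≠ 0 → G s = 0 := by
      intro s hs
      obtain ⟨v, hv0, hv⟩ := hXs s hs
      have h0 := eval_eq_zero_of_ker p n r hk
        (fun ij => (s ^ ((ij.1 : ℕ) * (ij.2 : ℕ)))⁻¹ * X' ij.1 ij.2 s)
        (fun j => v j) hv0 (fun i => by
          have := hv i i.2
          rw [Finset.sum_range] at this
          exact this)
      rw [eval_eq'] at h0
      have : G s = s ^ W * ∑ d ∈ r.support, coeff d r * ∏ ij : Fin p × Fin (n + 1),
          ((s ^ ((ij.1 : ℕ) * (ij.2 : ℕ)))⁻¹ * X' ij.1 ij.2 s) ^ d ij := by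
        rw [Finset.mul_sum]
        refine Finset.sum_congr rfl fun d hd => ?_
        have hle : wt d ≤ W := hmax d hd
        simp only [mul_pow, Finset.prod_mul_distrib]
        have hprod : ∏ ij : Fin p × Fin (n + 1), ((s ^ ((ij.1 : ℕ) * (ij.2 : ℕ)))⁻¹) ^ d ij =
            (s ^ wt d)⁻¹ := by
          rw [wt_eq, ← Finset.prod_pow_eq_pow_sum, ← Finset.prod_inv_distrib]
          refine Finset.prod_congr rfl fun ij _ => ?_
          rw [inv_pow, ← pow_mul, mul_comm (d ij)]
        rw [hprod, pow_sub₀ s hs hle]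
        ring
      rw [this, h0, mul_zero]
    have hG0 : G 0 = 0 := by
      have hEq : Set.EqOn G (fun _ => 0) ({0}ᶜ : Set ℂ) := fun s hs => hGs s hs
      exact congrFun (hGc.ext_on (dense_compl_singleton 0) continuous_const hEq) 0
    rw [map_zero, ← hG0]
    simp only [g, G, map_sum]
    rw [Finset.sum_filter]
    refine Finset.sum_congr rfl fun d hd => ?_
    have hle : wt d ≤ W := hmax d hd
    have hX0' : ∀ ij : Fin p × Fin (n + 1), X' ij.1 ij.2 0 = if B ij then 0 else y ij := by
      intro ij
      rw [hX0 _ ij.1.2]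
      have := Nat.lt_succ_iff.1 ij.2.2
      simp [B, y', this]
    split_ifs with h
    · rw [h.1, Nat.sub_self, pow_zero, one_mul, eval_monomial,
        Finsupp.prod_fintype _ _ (by simp)]
      congr 1
      refine Finset.prod_congr rfl fun ij _ => ?_
      rw [hX0']
      split_ifs with hb
      · rw [h.2 ij hb]; simp
      · rfl
    · symm
      by_cases hw : wt d = W
      · have : ∃ ij, B ij ∧ d ij ≠ 0 := by
          by_contra hcon
          push Not at hcon
          exact h ⟨hw, hcon⟩
        obtain ⟨ij, hb, hd0⟩ := this
        rw [Finset.prod_eq_zero (Finset.mem_univ ij)]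
        · simp
        · rw [hX0', if_pos hb, zero_pow hd0]
      · rw [zero_pow (by omega)]; simp
  have hc : coeff m g = coeff m r := by
    simp only [g, coeff_sum, coeff_monomial]
    rw [Finset.sum_ite_eq', if_pos]
    simp only [Finset.mem_filter]
    exact ⟨hm, rfl, hmB⟩
  rw [hg, coeff_zero] at hc
  exact (mem_support_iff.1 hm) hc.symm

end helpers

/-- For `p ≥ q ≥ 1`, the ideal of maximal (`q×q`) minors of the generic `p×q` matrix
over `ℂ` is prime. -/
theorem maximalMinorsIdeal_isPrime (p q : ℕ) (hq : 1 ≤ q) (hpq : q ≤ p) :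
    (maximalMinorsIdeal p q).IsPrime := by
  obtain ⟨n, rfl⟩ : ∃ n, q = n + 1 := ⟨q - 1, by omega⟩
  have h : maximalMinorsIdeal p (n + 1) = RingHom.ker (paramHom p n) := by
    apply le_antisymm (minors_le_ker p n)
    intro f hf
    obtain ⟨a, ha, r, hr, rfl⟩ := Submodule.mem_sup.1 (poly_reduce p (n + 1) f)
    rw [Submodule.restrictScalars_mem] at ha
    have hrk : r ∈ RingHom.ker (paramHom p n) :=
      (Ideal.add_mem_iff_right _ (minors_le_ker p n ha)).1 hf
    rw [normal_ker_zero p n r hr hrk, add_zero]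
    exact ha
  rw [h]
  exact RingHom.ker_isPrime _
end

section
/- Let p ≥ q ≥ 1 be natural numbers and let R = MvPolynomial (Fin p × Fin q) ℂ be the polynomial ring over ℂ in the entries x_{ij} of a generic p×q matrix X. Then the ideal of R generated by the maximal minors of X (the determinants of the q×q submatrices of X given by all strictly increasing row selections σ : Fin q → Fin p) has height equal to p − q + 1. -/
/-- The height of an ideal `I` of a commutative ring: the infimum, over the prime ideals `P`
containing `I`, of the lengths (in `ℕ∞`) of chains of prime ideals descending from `P`. -/
noncomputable def idealHeight {R : Type*} [CommRing R] (I : Ideal R) : ℕ∞ :=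
  ⨅ (P : PrimeSpectrum R) (_ : I ≤ P.asIdeal), Order.height P

/-- One-variable step: a prime of `B[X]` containing `aX+b` with `a ∉ Q` has height at least one
more than its contraction. -/
lemma height_step {B : Type*} [CommRing B] [IsNoetherianRing B] (Q : Ideal (Polynomial B))
    [Q.IsPrime] (a b : B) (h : Polynomial.C a * Polynomial.X + Polynomial.C b ∈ Q)
    (ha : Polynomial.C a ∉ Q) : (Q.comap Polynomial.C).height + 1 ≤ Q.height := by
  set q := Q.comap (Polynomial.C : B →+* Polynomial B) with hq
  have hqp : q.IsPrime := Ideal.IsPrime.comap _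
  have hcm : (q.map (Polynomial.C : B →+* Polynomial B)).comap Polynomial.C = q := by
    ext x
    rw [Ideal.mem_comap, Ideal.mem_map_C_iff]
    constructor
    · intro hx
      simpa using hx 0
    · intro hx n
      rw [Polynomial.coeff_C]
      split_ifs
      · exact hx
      · exact q.zero_mem
  have hlt : q.map (Polynomial.C : B →+* Polynomial B) < Q := by
    refine lt_of_le_of_ne Ideal.map_comap_le ?_
    intro he
    rw [← he, Ideal.mem_map_C_iff] at h
    have := h 1
    simp at this
    exact ha this
  have : (q.map (Polynomial.C : B →+* Polynomial B)).LiesOver q := ⟨hcm.symm⟩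
  have h1 := Ideal.height_eq_height_add_of_liesOver_of_hasGoingDown q
    (q.map (Polynomial.C : B →+* Polynomial B))
  have h2 := Ideal.height_add_one_le_of_lt_of_isPrime hlt
  refine le_trans ?_ h2
  gcongr
  rw [h1]
  exact le_self_add

lemma height_mv (T : Type) [Finite T] {A : Type} [CommRing A] [IsNoetherianRing A] :
    ∀ (Q : Ideal (MvPolynomial T A)) [Q.IsPrime],
    (∀ t, ∃ a b : A, MvPolynomial.C a * MvPolynomial.X t + MvPolynomial.C b ∈ Q ∧
      MvPolynomial.C a ∉ Q) → (Nat.card T : ℕ∞) ≤ Q.height := by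
  induction T using Finite.induction_empty_option with
  | @of_equiv α β e H =>
    intro Q _ h
    let f := (MvPolynomial.renameEquiv A e).toRingEquiv
    have hp : (Q.comap (f : MvPolynomial α A →+* MvPolynomial β A)).IsPrime := Ideal.IsPrime.comap _
    have := H (Q.comap (f : MvPolynomial α A →+* MvPolynomial β A)) (by
      intro t
      obtain ⟨a, b, h1, h2⟩ := h (e t)
      exact ⟨a, b, by simpa [f] using h1, by simpa [f] using h2⟩)
    rw [← Nat.card_congr e]
    refine this.trans (le_of_eq ?_)
    exact RingEquiv.height_comap f Q
  | h_empty => intro Q _ _; simp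
  | @h_option α _ H =>
    intro Q _ h
    let f := (MvPolynomial.optionEquivLeft A α).symm.toRingEquiv
    let Q1 := Q.comap (f : Polynomial (MvPolynomial α A) →+* MvPolynomial (Option α) A)
    have hp : Q1.IsPrime := Ideal.IsPrime.comap _
    have hQ1 : Q1.height = Q.height := RingEquiv.height_comap f Q
    have hC : ∀ x, f (Polynomial.C x) = MvPolynomial.rename some x := by
      intro x
      simp [f, MvPolynomial.optionEquivLeft]
    have hX : f Polynomial.X = MvPolynomial.X none := by
      simp [f]
    let Q2 := Q1.comap (Polynomial.C : MvPolynomial α A →+* _)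
    have hp2 : Q2.IsPrime := Ideal.IsPrime.comap _
    have h2 := H Q2 (by
      intro t
      obtain ⟨a, b, h1, h2⟩ := h (some t)
      refine ⟨a, b, ?_, ?_⟩
      · change f (Polynomial.C _) ∈ Q
        rw [hC]; simpa using h1
      · change ¬ (f (Polynomial.C _) ∈ Q)
        rw [hC]; simpa using h2)
    obtain ⟨a, b, h3, h4⟩ := h none
    have h5 := height_step Q1 (MvPolynomial.C a) (MvPolynomial.C b) (by
        change f _ ∈ Q
        rw [map_add, map_mul, hC, hC, hX]; simpa using h3) (by
        change ¬ (f _ ∈ Q)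
        rw [hC]; simpa using h4)
    rw [← hQ1]
    refine le_trans ?_ h5
    rw [Finite.card_option]
    push_cast
    gcongr

lemma height_supported {σ : Type} [Finite σ] (T : Set σ) (P : Ideal (MvPolynomial σ ℂ)) [P.IsPrime]
    (h : ∀ t ∈ T, ∃ a ∈ MvPolynomial.supported ℂ Tᶜ, ∃ b ∈ MvPolynomial.supported ℂ Tᶜ,
      a * MvPolynomial.X t + b ∈ P ∧ a ∉ P) : (Nat.card T : ℕ∞) ≤ P.height := by
  classical
  let g : MvPolynomial T (MvPolynomial (Tᶜ : Set σ) ℂ) ≃ₐ[ℂ] MvPolynomial σ ℂ :=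
    (MvPolynomial.sumAlgEquiv ℂ T (Tᶜ : Set σ)).symm.trans
      (MvPolynomial.renameEquiv ℂ (Equiv.Set.sumCompl T))
  have hgC : ∀ a : MvPolynomial (Tᶜ : Set σ) ℂ, g (MvPolynomial.C a) = MvPolynomial.rename Subtype.val a := by
    intro a
    induction a using MvPolynomial.induction_on with
    | C a => simp [g]
    | add p q hp hq => simp only [map_add, hp, hq]
    | mul_X p i hp =>
      simp only [map_mul, hp]
      simp [g]
  have hgX : ∀ t : T, g (MvPolynomial.X t) = MvPolynomial.X t.1 := by
    intro t
    simp [g]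
  let f := g.toRingEquiv
  let Q := P.comap (f : MvPolynomial T (MvPolynomial (Tᶜ : Set σ) ℂ) →+* MvPolynomial σ ℂ)
  have hp : Q.IsPrime := Ideal.IsPrime.comap _
  have hQ : Q.height = P.height := RingEquiv.height_comap f P
  rw [← hQ]
  apply height_mv
  rintro ⟨t, ht⟩
  obtain ⟨a, ha, b, hb, h1, h2⟩ := h t ht
  rw [MvPolynomial.supported_eq_range_rename] at ha hb
  obtain ⟨a, rfl⟩ := ha
  obtain ⟨b, rfl⟩ := hb
  refine ⟨a, b, ?_, ?_⟩
  · change g _ ∈ P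
    rw [map_add, map_mul, hgC, hgC, hgX]
    exact h1
  · change ¬ (g _ ∈ P)
    rw [hgC]
    exact h2

lemma minor_mem (p q : ℕ) (s : Fin q → Fin p) :
    ((genericMatrix p q).submatrix s id).det ∈ maximalMinorsIdeal p q := by
  by_cases hs : Function.Injective s
  · have hm : StrictMono (s ∘ Tuple.sort s) :=
      (Tuple.monotone_sort s).strictMono_of_injective (hs.comp (Tuple.sort s).injective)
    have h1 : ((genericMatrix p q).submatrix (s ∘ Tuple.sort s) id).det ∈ maximalMinorsIdeal p q :=
      Ideal.subset_span ⟨_, hm, rfl⟩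
    have h2 := Matrix.det_permute (Tuple.sort s).symm
      ((genericMatrix p q).submatrix (s ∘ Tuple.sort s) id)
    rw [Matrix.submatrix_submatrix] at h2
    have h3 : (s ∘ Tuple.sort s) ∘ (Tuple.sort s).symm = s := by
      ext; simp
    rw [h3, Function.comp_id] at h2
    rw [h2]
    exact Ideal.mul_mem_left _ _ h1
  · rw [Function.not_injective_iff] at hs
    obtain ⟨a, b, hab, hne⟩ := hs
    rw [Matrix.det_zero_of_row_eq hne (by ext j; simp [hab])]
    exact Ideal.zero_mem _

lemma minor_mem' (p q : ℕ) (s : Fin q → Fin p) (t : Fin q → Fin q) :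
    ((genericMatrix p q).submatrix s t).det ∈ maximalMinorsIdeal p q := by
  by_cases ht : Function.Injective t
  · let e := Equiv.ofBijective t (Finite.injective_iff_bijective.mp ht)
    have h1 := minor_mem p q (s ∘ e.symm)
    rw [← Matrix.det_submatrix_equiv_self e, Matrix.submatrix_submatrix] at h1
    have h3 : (s ∘ e.symm) ∘ e = s := by ext; simp
    rwa [h3] at h1
  · rw [Function.not_injective_iff] at ht
    obtain ⟨a, b, hab, hne⟩ := ht
    rw [Matrix.det_zero_of_column_eq hne (by intro j; simp [hab])]
    exact Ideal.zero_mem _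

lemma det_mem_subalgebra {R A : Type*} [CommRing R] [CommRing A] [Algebra R A]
    (S : Subalgebra R A) {n : ℕ} (M : Matrix (Fin n) (Fin n) A) (h : ∀ i j, M i j ∈ S) :
    M.det ∈ S := by
  rw [Matrix.det_apply']
  refine sum_mem fun σ _ => mul_mem ?_ (prod_mem fun i _ => h _ _)
  exact intCast_mem S _

lemma height_lower (p q : ℕ) (hpq : q ≤ p) (P : Ideal (MvPolynomial (Fin p × Fin q) ℂ))
    [hP : P.IsPrime] (hI : maximalMinorsIdeal p q ≤ P) : ((p - q + 1 : ℕ) : ℕ∞) ≤ P.height := by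
  classical
  let X := genericMatrix p q
  let good : ℕ → Prop := fun r => ∃ (s : Fin r → Fin p) (t : Fin r → Fin q),
    (X.submatrix s t).det ∉ P
  have h0 : good 0 := ⟨Fin.elim0, Fin.elim0, by
    rw [Matrix.det_isEmpty]
    exact fun h => hP.ne_top ((Ideal.eq_top_iff_one _).mpr h)⟩
  have hgq : ¬ good q := by
    rintro ⟨s, t, h⟩
    exact h (hI (minor_mem' p q s t))
  obtain ⟨r, hrq, ⟨s, t, hst⟩, hr1⟩ : ∃ r, r < q ∧ good r ∧ ¬ good (r + 1) := by
    by_contra! hcon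
    have : ∀ n, n ≤ q → good n := by
      intro n
      induction n with
      | zero => intro _; exact h0
      | succ k ih => intro hk; exact hcon k (by omega) (ih (by omega))
    exact hgq (this q le_rfl)
  obtain ⟨j, hj⟩ : ∃ j, j ∉ Set.range t := by
    by_contra! hcon
    have := Fintype.card_le_of_surjective t hcon
    simp at this
    omega
  let T : Set (Fin p × Fin q) := (fun i => (i, j)) '' (Set.range s)ᶜ
  have hTs : ∀ k j', (s k, j') ∈ Tᶜ := by
    rintro k j' ⟨i, hi, he⟩
    simp only [Prod.mk.injEq] at he
    exact hi ⟨k, he.1.symm⟩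
  have hTt : ∀ i k, (i, t k) ∈ Tᶜ := by
    rintro i k ⟨i', hi, he⟩
    simp only [Prod.mk.injEq] at he
    exact hj ⟨k, he.2.symm⟩
  have hcard : p - q + 1 ≤ Nat.card T := by
    have h1 : Nat.card T = ((Set.range s)ᶜ).ncard := by
      rw [Nat.card_coe_set_eq]
      exact Set.ncard_image_of_injective _ (fun a b h => (Prod.mk.inj h).1)
    have h2 := Set.ncard_add_ncard_compl (Set.range s)
    have h3 : (Set.range s).ncard ≤ r := by
      rw [← Set.image_univ]
      refine (Set.ncard_image_le).trans ?_
      simp [Set.ncard_univ]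
    simp at h2
    omega
  refine le_trans (by exact_mod_cast hcard) (height_supported T P ?_)
  rintro _ ⟨i, hi, rfl⟩
  have hd : (X.submatrix (Fin.cons i s : Fin (r+1) → Fin p) (Fin.cons j t : Fin (r+1) → Fin q)).det
      ∈ P := by
    by_contra hcon
    exact hr1 ⟨_, _, hcon⟩
  rw [Matrix.det_succ_row_zero, Fin.sum_univ_succ] at hd
  have hs0 : (X.submatrix (Fin.cons i s : Fin (r+1) → Fin p)
      (Fin.cons j t : Fin (r+1) → Fin q)).submatrix Fin.succ (Fin.succAbove 0) =
      X.submatrix s t := by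
    ext a b
    simp
  rw [hs0] at hd
  refine ⟨(X.submatrix s t).det, ?_, ∑ k : Fin r, (-1) ^ (k.succ : ℕ) *
    (X.submatrix (Fin.cons i s : Fin (r+1) → Fin p) (Fin.cons j t : Fin (r+1) → Fin q)) 0 k.succ *
    ((X.submatrix (Fin.cons i s : Fin (r+1) → Fin p)
      (Fin.cons j t : Fin (r+1) → Fin q)).submatrix Fin.succ k.succ.succAbove).det, ?_, ?_, hst⟩
  · apply det_mem_subalgebra
    intro a b
    exact MvPolynomial.X_mem_supported.mpr (hTs _ _)
  · refine sum_mem fun k _ => mul_mem (mul_mem ?_ ?_) (det_mem_subalgebra _ _ ?_)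
    · exact pow_mem (neg_mem (one_mem _)) _
    · simp only [Matrix.submatrix_apply, Fin.cons_zero, Fin.cons_succ]
      exact MvPolynomial.X_mem_supported.mpr (hTt _ _)
    · intro a b
      simp only [Matrix.submatrix_apply, Fin.cons_succ]
      exact MvPolynomial.X_mem_supported.mpr (hTs _ _)
  · convert hd using 2
    simp [X, genericMatrix, mul_comm]

lemma det_zero_of_bordered {R : Type*} [CommRing R] [IsDomain R] {p r : ℕ}
    (M : Matrix (Fin p) (Fin (r + 1)) R) (s : Fin r → Fin p)
    (hΔ : (M.submatrix s Fin.succ).det ≠ 0)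
    (h : ∀ i, (M.submatrix (Fin.cons i s : Fin (r+1) → Fin p) id).det = 0)
    (σ : Fin (r + 1) → Fin p) : (M.submatrix σ id).det = 0 := by
  rw [← Matrix.exists_mulVec_eq_zero_iff]
  refine ⟨fun j => (-1) ^ (j : ℕ) * (M.submatrix s j.succAbove).det, ?_, ?_⟩
  · intro h0
    have := congrFun h0 0
    apply hΔ
    simpa using this
  · ext k
    have := h (σ k)
    rw [Matrix.det_succ_row_zero] at this
    simp only [Pi.zero_apply, Matrix.mulVec, dotProduct]
    rw [← this]
    refine Finset.sum_congr rfl fun j _ => ?_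
    have h2 : (M.submatrix (Fin.cons (σ k) s : Fin (r+1) → Fin p) id).submatrix Fin.succ
        j.succAbove = M.submatrix s j.succAbove := by
      ext a b
      simp
    rw [h2]
    simp only [Matrix.submatrix_apply, Fin.cons_zero, id]
    ring

lemma height_upper (p r : ℕ) (hpq : r + 1 ≤ p) :
    ∃ P : Ideal (MvPolynomial (Fin p × Fin (r + 1)) ℂ), P.IsPrime ∧
      maximalMinorsIdeal p (r + 1) ≤ P ∧ P.height ≤ ((p - r : ℕ) : ℕ∞) := by
  classical
  let X := genericMatrix p (r + 1)
  let s : Fin r → Fin p := Fin.castLE (by omega)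
  have hsinj : Function.Injective s := Fin.castLE_injective _
  let d : Fin p → MvPolynomial (Fin p × Fin (r + 1)) ℂ := fun i =>
    (X.submatrix (Fin.cons i s : Fin (r+1) → Fin p) id).det
  let F : Finset (Fin p) := (Finset.univ.image s)ᶜ
  have hF : F.card = p - r := by
    rw [Finset.card_compl, Finset.card_image_of_injective _ hsinj]
    simp
  let J := Ideal.span ((F.image d : Finset _) : Set (MvPolynomial (Fin p × Fin (r + 1)) ℂ))
  let ev : MvPolynomial (Fin p × Fin (r + 1)) ℂ →+* ℂ :=
    MvPolynomial.eval (fun x => if (x.2 : ℕ) = x.1 + 1 then 1 else 0)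
  have hev0 : ∀ i, ev (d i) = 0 := by
    intro i
    simp only [d, RingHom.map_det]
    apply Matrix.det_eq_zero_of_column_eq_zero 0
    intro k
    simp [X, genericMatrix, ev]
  have hev1 : ev (X.submatrix s Fin.succ).det = 1 := by
    rw [RingHom.map_det]
    convert Matrix.det_one (n := Fin r) (R := ℂ)
    ext a b
    simp [X, genericMatrix, ev, s, Matrix.one_apply, Fin.ext_iff, eq_comm]
  have hJ : J ≤ RingHom.ker ev := by
    rw [Ideal.span_le]
    intro x hx
    obtain ⟨i, _, rfl⟩ := Finset.mem_image.mp (Finset.mem_coe.mp hx)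
    exact hev0 i
  have hker : (RingHom.ker ev).IsPrime := RingHom.ker_isPrime ev
  obtain ⟨P, hPm, hPle⟩ := Ideal.exists_minimalPrimes_le hJ
  have hP : P.IsPrime := hPm.1.1
  have hJP : J ≤ P := hPm.1.2
  refine ⟨P, hP, ?_, ?_⟩
  · have hdP : ∀ i, d i ∈ P := by
      intro i
      by_cases hi : i ∈ F
      · exact hJP (Ideal.subset_span (Finset.mem_coe.mpr (Finset.mem_image_of_mem d hi)))
      · simp only [F, Finset.mem_compl, not_not, Finset.mem_image, Finset.mem_univ, true_and] at hi
        obtain ⟨k, rfl⟩ := hi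
        have : d (s k) = 0 :=
          Matrix.det_zero_of_row_eq (i := 0) (j := k.succ) (Fin.succ_ne_zero k).symm
            (by ext; simp)
        rw [this]
        exact P.zero_mem
    have hΔ : (X.submatrix s Fin.succ).det ∉ P := by
      intro h
      have : ev _ = 0 := hPle h
      rw [hev1] at this
      exact one_ne_zero this
    unfold maximalMinorsIdeal
    rw [Ideal.span_le]
    rintro _ ⟨σ, -, rfl⟩
    have key := det_zero_of_bordered (X.map (Ideal.Quotient.mk P)) s (by
      intro h
      apply hΔ
      rw [← Ideal.Quotient.eq_zero_iff_mem, RingHom.map_det]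
      exact h) (by
      intro i
      have := hdP i
      rw [← Ideal.Quotient.eq_zero_iff_mem, RingHom.map_det] at this
      exact this) σ
    rw [SetLike.mem_coe, ← Ideal.Quotient.eq_zero_iff_mem, RingHom.map_det]
    exact key
  · refine (Ideal.height_le_card_of_mem_minimalPrimes_span_finset hPm).trans ?_
    rw [← hF]
    exact_mod_cast Finset.card_image_le

/-- For `p ≥ q ≥ 1`, the ideal of maximal (`q×q`) minors of the generic `p×q` matrix
over `ℂ` has height `p − q + 1`. -/
theorem maximalMinorsIdeal_height (p q : ℕ) (hq : 1 ≤ q) (hpq : q ≤ p) :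
    idealHeight (maximalMinorsIdeal p q) = (p - q + 1 : ℕ) := by
  apply le_antisymm
  · obtain ⟨r, rfl⟩ : ∃ r, q = r + 1 := ⟨q - 1, by omega⟩
    obtain ⟨P, hP, hle, hh⟩ := height_upper p r hpq
    refine (iInf₂_le (⟨P, hP⟩ : PrimeSpectrum _) hle).trans ?_
    rw [← PrimeSpectrum.height_eq_orderHeight]
    have : p - (r + 1) + 1 = p - r := by omega
    rw [this]
    exact hh
  · refine le_iInf₂ fun P hP => ?_
    rw [← PrimeSpectrum.height_eq_orderHeight]
    have := P.isPrime
    exact height_lower p q hpq P.asIdeal hP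
end

section
/- Let ι be a nonempty finite index set and for each i ∈ ι let p_i ≥ q_i ≥ 1 be natural numbers. Let M = ∏_{i∈ι} M_{p_i,q_i} be the product of the spaces of p_i×q_i complex matrices, let D = ∏_{i∈ι} D_{p_i,q_i} ⊆ M be the set of tuples (A_i) such that every A_i has rank less than q_i, and let W = M \ D. Set c = Σ_{i∈ι} (p_i − q_i + 1). Then for every natural number k with k ≤ 2c − 2, the k-th homotopy group of W (based at any point) is trivial; that is, W is (2c−2)-connected. -/
open scoped unitInterval

lemma straight_line_homotopic {k : ℕ} {E : Type*} [NormedAddCommGroup E] [NormedSpace ℝ E]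
    {P : E → Prop} {x : {A : E // P A}} (f g : GenLoop (Fin k) {A : E // P A} x)
    (h : ∀ (t : I) s, P ((1 - (t : ℝ)) • (f s : E) + (t : ℝ) • (g s : E))) :
    GenLoop.Homotopic f g := by
  have hf : Continuous f := f.1.continuous
  have hg : Continuous g := g.1.continuous
  refine ⟨⟨⟨⟨fun ts => ⟨_, h ts.1 ts.2⟩, ?_⟩, ?_, ?_⟩, ?_⟩⟩
  · fun_prop
  · intro s
    apply Subtype.ext
    simp
  · intro s
    apply Subtype.ext
    simp
  · intro t s hs
    apply Subtype.ext
    have h1 := f.2 s hs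
    have h2 := g.2 s hs
    have h1' : f s = x := h1
    have h2' : g s = x := h2
    have h3 : f.1 s = x := h1
    simp only [ContinuousMap.coe_mk]
    rw [h1', h2', h3, ← add_smul]
    simp

lemma isClosed_cube_boundary (k : ℕ) : IsClosed (Cube.boundary (Fin k)) := by
  have : Cube.boundary (Fin k) = ⋃ i, ({y | y i = 0} ∪ {y | y i = 1}) := by
    ext y; simp [Cube.boundary]
  rw [this]
  refine isClosed_iUnion_of_finite fun i => IsClosed.union ?_ ?_
  · exact isClosed_eq (continuous_apply i) continuous_const
  · exact isClosed_eq (continuous_apply i) continuous_const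

lemma exists_cone_point {k : ℕ} {E : Type*} [NormedAddCommGroup E] [NormedSpace ℝ E]
    [FiniteDimensional ℝ E] {D : Set E} {J : Type*} [Finite J] [Nonempty J] {F : J → Type*}
    [∀ j, NormedAddCommGroup (F j)] [∀ j, NormedSpace ℝ (F j)] [∀ j, FiniteDimensional ℝ (F j)]
    (φ : ∀ j, F j → E) (hφ : ∀ j, ContDiff ℝ 1 (φ j)) (hD : D ⊆ ⋃ j, Set.range (φ j))
    (hdim : ∀ j, Module.finrank ℝ (F j) + k + 1 < Module.finrank ℝ E)
    (hcone : ∀ r : ℝ, 0 < r → ∀ A ∈ D, r • A ∈ D)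
    (g : (Fin k → ℝ) → E) (hg : ContDiff ℝ 1 g) (x : E) (ε : ℝ) (hε : 0 < ε) :
    ∃ v ∈ Metric.ball x ε, ∀ t : ℝ, 0 < t → ∀ s, (1 - t) • g s + t • v ∉ D := by
  let Φ : ∀ j, F j × (ℝ × (Fin k → ℝ)) → E := fun j z => φ j z.1 - z.2.1 • g z.2.2
  have hΦ : ∀ j, ContDiff ℝ 1 (Φ j) := fun j => by
    have := hφ j
    fun_prop
  have hd : Dense (⋃ j, Set.range (Φ j))ᶜ := by
    apply dense_compl_of_dimH_lt_finrank
    have hle : dimH (⋃ j, Set.range (Φ j)) ≤ ((Module.finrank ℝ E - 1 : ℕ) : ENNReal) := by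
      rw [dimH_iUnion]
      refine iSup_le fun j => (hΦ j).dimH_range_le.trans ?_
      have h1 := hdim j
      have h2 : Module.finrank ℝ (F j × (ℝ × (Fin k → ℝ))) = Module.finrank ℝ (F j) + (1 + k) := by
        simp [Module.finrank_prod]
      rw [h2]
      exact_mod_cast (by omega)
    refine hle.trans_lt ?_
    have h1 := hdim (Classical.arbitrary J)
    exact_mod_cast (by omega)
  obtain ⟨v, hv, hvb⟩ := hd.exists_mem_open Metric.isOpen_ball ⟨x, Metric.mem_ball_self hε⟩
  refine ⟨v, hvb, fun t ht s hs => hv ?_⟩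
  have h1 := hcone t⁻¹ (by positivity) _ hs
  obtain ⟨j, w, hw⟩ := Set.mem_iUnion.1 (hD h1)
  refine Set.mem_iUnion.2 ⟨j, (w, (t⁻¹ * (1 - t), s)), ?_⟩
  change φ j w - (t⁻¹ * (1 - t)) • g s = v
  rw [hw, smul_add, smul_smul, smul_smul, inv_mul_cancel₀ ht.ne']
  simp

theorem subsingleton_homotopyGroup_compl {k : ℕ} {E : Type*} [NormedAddCommGroup E]
    [NormedSpace ℝ E] [FiniteDimensional ℝ E] {P : E → Prop} (hP : IsOpen {A | P A})
    {J : Type*} [Finite J] [Nonempty J] {F : J → Type*}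
    [∀ j, NormedAddCommGroup (F j)] [∀ j, NormedSpace ℝ (F j)] [∀ j, FiniteDimensional ℝ (F j)]
    (φ : ∀ j, F j → E) (hφ : ∀ j, ContDiff ℝ 1 (φ j))
    (hD : {A | ¬ P A} ⊆ ⋃ j, Set.range (φ j))
    (hdim : ∀ j, Module.finrank ℝ (F j) + k + 1 < Module.finrank ℝ E)
    (hcone : ∀ r : ℝ, 0 < r → ∀ A, ¬ P A → ¬ P (r • A))
    (x : {A : E // P A}) :
    Subsingleton (HomotopyGroup (Fin k) {A : E // P A} x) := by
  suffices h : ∀ f : GenLoop (Fin k) {A : E // P A} x, GenLoop.Homotopic f GenLoop.const by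
    constructor
    intro a b
    induction a using Quotient.inductionOn with | _ a
    induction b using Quotient.inductionOn with | _ b
    exact Quotient.sound ((h a).trans (h b).symm)
  intro f
  have hf : Continuous f := f.1.continuous
  have hf' : Continuous fun s => (f s : E) := continuous_subtype_val.comp hf
  -- a uniform radius
  obtain ⟨ε, hε, hthick⟩ : ∃ ε, 0 < ε ∧ Metric.thickening ε
      (Set.range (fun s => (f s : E)) ∪ {(x : E)}) ⊆ {A | P A} := by
    apply IsCompact.exists_thickening_subset_open
    · exact (isCompact_range hf').union isCompact_singleton
    · exact hP
    · rintro A (⟨s, rfl⟩ | rfl)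
      · exact (f s).2
      · exact x.2
  have hballf : ∀ s, ∀ A ∈ Metric.ball (f s : E) ε, P A := fun s A hA =>
    hthick (Metric.mem_thickening_iff.2 ⟨_, Or.inl ⟨s, rfl⟩, hA⟩)
  have hballx : ∀ A ∈ Metric.ball (x : E) ε, P A := fun A hA =>
    hthick (Metric.mem_thickening_iff.2 ⟨_, Or.inr rfl, hA⟩)
  -- the smooth approximation
  let f' : (Fin k → ℝ) → E := fun y => f (fun i => Set.projIcc 0 1 zero_le_one (y i))
  have hf'c : Continuous f' := by
    refine hf'.comp (continuous_pi fun i => continuous_projIcc.comp (continuous_apply i))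
  obtain ⟨g, hgs, hga, -⟩ := hf'c.exists_contDiff_approx 1 (ε := fun _ => ε / 2)
    continuous_const (fun _ => by positivity)
  let ι' : (Fin k → I) → (Fin k → ℝ) := fun s i => s i
  have hι' : Continuous ι' := by fun_prop
  have hgc : Continuous fun s => g (ι' s) := hgs.continuous.comp hι'
  have hgf : ∀ s, dist (g (ι' s)) (f s) < ε / 2 := by
    intro s
    have := hga (ι' s)
    have h2 : f' (ι' s) = f s := by simp [f', ι']
    rwa [h2] at this
  obtain ⟨v, hv, hvcone⟩ := exists_cone_point φ hφ hD hdim hcone g hgs x ε hε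
  -- the cutoff function
  obtain ⟨χ, hχ0, hχ1, hχ⟩ := exists_continuous_zero_one_of_isClosed
    (s := Cube.boundary (Fin k)) (t := {s | ε / 2 ≤ dist (f s : E) x})
    (isClosed_cube_boundary k) (isClosed_le continuous_const (by fun_prop)) (by
      rw [Set.disjoint_left]
      intro s hs hs'
      have : f s = x := f.2 s hs
      simp only [Set.mem_ofPred_eq, this, dist_self] at hs'
      linarith)
  have hχc : Continuous χ := χ.continuous
  have key : ∀ s, χ s = 1 ∨ ((f s : E) ∈ Metric.ball (x : E) ε ∧
      g (ι' s) ∈ Metric.ball (x : E) ε) := by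
    intro s
    by_cases h : ε / 2 ≤ dist (f s : E) x
    · exact Or.inl (hχ1 h)
    · right
      push Not at h
      refine ⟨Metric.mem_ball.2 (by linarith), Metric.mem_ball.2 ?_⟩
      have := dist_triangle (g (ι' s)) (f s) x
      linarith [hgf s]
  have hcomb : ∀ {c : E} {a b : E} {t : ℝ}, a ∈ Metric.ball c ε → b ∈ Metric.ball c ε →
      0 ≤ t → t ≤ 1 → (1 - t) • a + t • b ∈ Metric.ball c ε := by
    intro c a b t ha hb h0 h1
    exact convex_ball c ε ha hb (by linarith) h0 (by ring)
  have hcone' : ∀ (t : I) s, χ s = 1 → P ((1 - (t : ℝ)) • g (ι' s) + (t : ℝ) • v) := by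
    intro t s _
    rcases t.2.1.eq_or_lt with h | h
    · rw [← h]
      simpa using hballf s _ (Metric.mem_ball.2 (by linarith [hgf s]))
    · by_contra hc
      exact hvcone t h _ hc
  let h1 : (Fin k → I) → E := fun s => (1 - χ s) • (f s : E) + χ s • g (ι' s)
  let h2 : (Fin k → I) → E := fun s => (1 - χ s) • (f s : E) + χ s • v
  have h1f : ∀ s, h1 s ∈ Metric.ball (f s : E) ε := fun s =>
    hcomb (Metric.mem_ball_self hε) (Metric.mem_ball.2 (by linarith [hgf s])) (hχ s).1 (hχ s).2
  have h2x : ∀ s, h2 s ∈ Metric.ball (x : E) ε := by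
    intro s
    rcases key s with h | h
    · simpa [h2, h] using hv
    · exact hcomb h.1 hv (hχ s).1 (hχ s).2
  have hbd : ∀ s ∈ Cube.boundary (Fin k), χ s = 0 ∧ f s = x := fun s hs => ⟨hχ0 hs, f.2 s hs⟩
  let l1 : GenLoop (Fin k) {A : E // P A} x :=
    ⟨⟨fun s => ⟨h1 s, hballf s _ (h1f s)⟩, by fun_prop⟩, fun s hs => by
      apply Subtype.ext
      simp [h1, hbd s hs]⟩
  let l2 : GenLoop (Fin k) {A : E // P A} x :=
    ⟨⟨fun s => ⟨h2 s, hballx _ (h2x s)⟩, by fun_prop⟩, fun s hs => by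
      apply Subtype.ext
      simp [h2, hbd s hs]⟩
  have e1 : GenLoop.Homotopic f l1 := straight_line_homotopic _ _ fun t s =>
    hballf s _ (hcomb (Metric.mem_ball_self hε) (h1f s) t.2.1 t.2.2)
  have e2 : GenLoop.Homotopic l1 l2 := straight_line_homotopic _ _ fun t s => by
    change P ((1 - (t : ℝ)) • h1 s + (t : ℝ) • h2 s)
    rcases key s with h | h
    · simpa [h1, h2, h] using hcone' t s h
    · exact hballx _ (hcomb (hcomb h.1 h.2 (hχ s).1 (hχ s).2) (h2x s) t.2.1 t.2.2)
  have e3 : GenLoop.Homotopic l2 GenLoop.const := straight_line_homotopic _ _ fun t s =>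
    hballx _ (hcomb (h2x s) (Metric.mem_ball_self hε) t.2.1 t.2.2)
  exact (e1.trans e2).trans e3

lemma rank_lt_iff_not_linearIndependent {p q : ℕ} (A : Matrix (Fin p) (Fin q) ℂ) :
    A.rank < q ↔ ¬ LinearIndependent ℂ A.col := by
  rw [linearIndependent_iff_card_le_finrank_span, Set.finrank, ← Matrix.rank_eq_finrank_span_cols,
    Fintype.card_fin, not_le]

/-- Parameters for matrices whose column `j` is a combination of the others. -/
abbrev DegParam (p q : ℕ) (j : Fin q) : Type :=
  ({l : Fin q // l ≠ j} → Fin p → ℂ) × ({l : Fin q // l ≠ j} → ℂ)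

/-- The degenerate matrix attached to the parameters. -/
def degMap (p q : ℕ) (j : Fin q) (z : DegParam p q j) : Fin p → Fin q → ℂ := fun a l =>
  if h : l = j then ∑ m, z.2 m * z.1 m a else z.1 ⟨l, h⟩ a

lemma contDiff_degMap (p q : ℕ) (j : Fin q) : ContDiff ℝ 1 (degMap p q j) := by
  refine contDiff_pi.2 fun a => contDiff_pi.2 fun l => ?_
  unfold degMap
  by_cases h : l = j
  · simp only [h, dite_true]
    fun_prop
  · simp only [h, dite_false]
    fun_prop

lemma exists_degMap {p q : ℕ} (A : Matrix (Fin p) (Fin q) ℂ) (hA : A.rank < q) :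
    ∃ j z, degMap p q j z = A := by
  rw [rank_lt_iff_not_linearIndependent, linearIndependent_iff_notMem_span] at hA
  push Not at hA
  obtain ⟨j, hj⟩ := hA
  have himg : A.col '' (Set.univ \ {j}) = Set.range (fun m : {l : Fin q // l ≠ j} => A.col m) := by
    ext w; simp
  rw [himg, Submodule.mem_span_range_iff_exists_fun] at hj
  obtain ⟨c, hc⟩ := hj
  refine ⟨j, (fun m => A.col m, c), ?_⟩
  funext a l
  unfold degMap
  by_cases h : l = j
  · subst h
    have := congrFun hc a
    simpa [Finset.sum_apply] using this
  · simp [h]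

lemma finrank_degParam (p q : ℕ) (j : Fin q) :
    Module.finrank ℝ (DegParam p q j) = (q - 1) * (p * 2) + (q - 1) * 2 := by
  simp [Module.finrank_prod, Module.finrank_pi_fintype, Complex.finrank_real_complex]



/-- Let `ι` be a nonempty finite index set and, for each `i`, let `p i ≥ q i ≥ 1`.
Let `W` be the complement, in the product `M = ∏ i, M_{p i, q i}` of the spaces of
`p i × q i` complex matrices, of the product `D = ∏ i, D_{p i, q i}` of the sets of
matrices of rank less than `q i`. Set `c = ∑ i, (p i − q i + 1)`. Then for every `k`
with `k ≤ 2c − 2`, the `k`-th homotopy group of `W` (based at any point) is trivial: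
`W` is `(2c−2)`-connected. -/
theorem complement_of_product_of_degenerate_matrices_highly_connected
    {ι : Type*} [Fintype ι] [Nonempty ι] (p q : ι → ℕ)
    (hq : ∀ i, 1 ≤ q i) (hpq : ∀ i, q i ≤ p i)
    (k : ℕ) (hk : k ≤ 2 * (∑ i, (p i - q i + 1)) - 2)
    (x : {A : ∀ i, Matrix (Fin (p i)) (Fin (q i)) ℂ // ¬ ∀ i, (A i).rank < q i}) :
    Subsingleton (HomotopyGroup (Fin k)
      {A : ∀ i, Matrix (Fin (p i)) (Fin (q i)) ℂ // ¬ ∀ i, (A i).rank < q i} x) := by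
  classical
  have : Nonempty (∀ i, Fin (q i)) := ⟨fun i => ⟨0, hq i⟩⟩
  refine subsingleton_homotopyGroup_compl (k := k) (E := ∀ i, Fin (p i) → Fin (q i) → ℂ)
    (P := fun A => ¬ ∀ i, Matrix.rank (A i : Matrix (Fin (p i)) (Fin (q i)) ℂ) < q i) ?_
    (J := ∀ i, Fin (q i)) (F := fun J => ∀ i, DegParam (p i) (q i) (J i))
    (fun J z i => degMap (p i) (q i) (J i) (z i)) ?_ ?_ ?_ ?_ x
  · have : {A : ∀ i, Fin (p i) → Fin (q i) → ℂ |
        ¬ ∀ i, Matrix.rank (A i : Matrix (Fin (p i)) (Fin (q i)) ℂ) < q i} =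
        ⋃ i, (fun (A : ∀ i, Fin (p i) → Fin (q i) → ℂ) (l : Fin (q i)) (a : Fin (p i)) =>
          A i a l) ⁻¹' {v | LinearIndependent ℂ v} := by
      ext A
      simp only [Set.mem_ofPred_eq, Set.mem_iUnion, Set.mem_preimage, not_forall]
      refine exists_congr fun i => ?_
      exact (not_congr (rank_lt_iff_not_linearIndependent (Matrix.of (A i)))).trans not_not
    rw [this]
    refine isOpen_iUnion fun i => IsOpen.preimage (by fun_prop) ?_
    exact isOpen_setOfPred_linearIndependent
  · intro J
    refine contDiff_pi.2 fun i => (contDiff_degMap _ _ _).comp ?_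
    exact (ContinuousLinearMap.proj (R := ℝ)
      (φ := fun i => DegParam (p i) (q i) (J i)) i).contDiff
  · intro A hA
    simp only [Set.mem_ofPred_eq, not_not] at hA
    choose J z hz using fun i => exists_degMap _ (hA i)
    exact Set.mem_iUnion.2 ⟨J, z, funext hz⟩
  · intro J
    have e1 : Module.finrank ℝ (∀ i, DegParam (p i) (q i) (J i)) =
        ∑ i, ((q i - 1) * (p i * 2) + (q i - 1) * 2) := by
      rw [Module.finrank_pi_fintype]
      exact Finset.sum_congr rfl fun i _ => finrank_degParam _ _ _
    have e2 : Module.finrank ℝ (∀ i, Fin (p i) → Fin (q i) → ℂ) = ∑ i, p i * (q i * 2) := by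
      simp [Module.finrank_pi_fintype, Complex.finrank_real_complex]
    have e3 : ∑ i, p i * (q i * 2) = ∑ i, ((q i - 1) * (p i * 2) + (q i - 1) * 2) +
        2 * ∑ i, (p i - q i + 1) := by
      rw [Finset.mul_sum, ← Finset.sum_add_distrib]
      refine Finset.sum_congr rfl fun i _ => ?_
      obtain ⟨b, hb⟩ := Nat.exists_eq_add_of_le (hpq i)
      obtain ⟨a, ha⟩ := Nat.exists_eq_add_of_le (hq i)
      rw [hb, ha]
      simp only [Nat.add_sub_cancel_left]
      ring
    have e4 : 0 < ∑ i, (p i - q i + 1) :=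
      Finset.sum_pos (fun i _ => Nat.succ_pos _) Finset.univ_nonempty
    rw [e1, e2, e3]
    omega
  · intro r hr A hA
    simp only [not_not] at hA ⊢
    intro i
    refine lt_of_le_of_lt ?_ (hA i)
    have : (Matrix.of ((r • A) i) : Matrix (Fin (p i)) (Fin (q i)) ℂ) =
        (Matrix.of (A i) : Matrix (Fin (p i)) (Fin (q i)) ℂ) * ((r : ℂ) • (1 : Matrix (Fin (q i)) (Fin (q i)) ℂ)) := by
      rw [Matrix.mul_smul, Matrix.mul_one]
      ext a l
      simp
    change (Matrix.of ((r • A) i)).rank ≤ (Matrix.of (A i)).rank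
    rw [this]
    exact Matrix.rank_mul_le_left _ _
end
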